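/- arXiv:2106.15094 — 6 statements merged into one kernel-verified Lean document; each statement's English description precedes it below -/
import Mathlib

section
/- There exists a unique allocation v ∈ 𝒢_N ↦ (φ_i(v))_{i∈[N]} ∈ ℝ^N satisfying: (efficiency) ∑_{i∈[N]} φ_i(v) = v([N]); (symmetry) if v(S∪{i}) = v(S∪{j}) for all S ⊆ [N]∖{i,j} then φ_i(v) = φ_j(v); (null-player) if v(S∪{i}) − v(S) = 0 for all S ⊆ [N]∖{i} then φ_i(v) = 0; (linearity) φ_i(αv + α′v′) = αφ_i(v) + α′φ_i(v′) for all α,α′ ∈ ℝ and v,v′ ∈ 𝒢_N. Moreover, this allocation is given by the explicit formula φ_i(v) = ∑_{S ⊆ [N]∖{i}} |S|!(N−1−|S|)!/N! · (v(S∪{i}) − v(S)). -/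
open Finset

/-- A cooperative game on `[N]`: a function on coalitions vanishing on the empty coalition. -/
def Game (N : ℕ) := {v : Finset (Fin N) → ℝ // v ∅ = 0}

/-- The linear combination `α v + α' v'` of two games. -/
def gameLC {N : ℕ} (a b : ℝ) (v w : Game N) : Game N :=
  ⟨fun S => a * v.1 S + b * w.1 S, by simp [v.2, w.2]⟩

/-- The Shapley axioms: efficiency, symmetry, null-player, linearity. -/
def ShapleyAxioms {N : ℕ} (φ : Game N → Fin N → ℝ) : Prop :=
  -- efficiency
  (∀ v : Game N, ∑ i : Fin N, φ v i = v.1 Finset.univ) ∧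
  -- symmetry
  (∀ (v : Game N) (i j : Fin N),
    (∀ S : Finset (Fin N), i ∉ S → j ∉ S → v.1 (insert i S) = v.1 (insert j S)) →
    φ v i = φ v j) ∧
  -- null-player
  (∀ (v : Game N) (i : Fin N),
    (∀ S : Finset (Fin N), i ∉ S → v.1 (insert i S) - v.1 S = 0) → φ v i = 0) ∧
  -- linearity
  (∀ (a b : ℝ) (v w : Game N) (i : Fin N),
    φ (gameLC a b v w) i = a * φ v i + b * φ w i)

/-- The Shapley formula. -/
noncomputable def shapleyValue {N : ℕ} (v : Game N) (i : Fin N) : ℝ :=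
  ∑ S ∈ ((Finset.univ : Finset (Fin N)).erase i).powerset,
    ((S.card.factorial : ℝ) * ((N - 1 - S.card).factorial : ℝ)) / (N.factorial : ℝ) *
      (v.1 (insert i S) - v.1 S)

theorem mem_powerset_univ_erase {α : Type*} [Fintype α] [DecidableEq α] {i : α} {S : Finset α} :
    S ∈ ((Finset.univ : Finset α).erase i).powerset ↔ i ∉ S := by
  simp [Finset.mem_powerset, Finset.subset_erase]

theorem sum_sum_insert {α : Type*} [Fintype α] [DecidableEq α] (w : ℕ → ℝ)
    (f : Finset α → ℝ) :
    ∑ i : α, ∑ S ∈ ((Finset.univ : Finset α).erase i).powerset, w S.card * f (insert i S) =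
      ∑ T : Finset α, T.card * w (T.card - 1) * f T := by
  have h (i : α) :
      ∑ S ∈ ((Finset.univ : Finset α).erase i).powerset, w S.card * f (insert i S) =
        ∑ T : Finset α, if i ∈ T then w (T.card - 1) * f T else 0 := by
    rw [← Finset.sum_filter]
    refine Finset.sum_nbij' (fun S => insert i S) (fun T => T.erase i) ?_ ?_ ?_ ?_ ?_
    · simp
    · exact fun T _ => mem_powerset_univ_erase.2 (Finset.notMem_erase i T)
    · intro S hS
      exact Finset.erase_insert (mem_powerset_univ_erase.1 hS)
    · intro T hT
      exact Finset.insert_erase (Finset.mem_filter.1 hT).2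
    · intro S hS
      simp [Finset.card_insert_of_notMem (mem_powerset_univ_erase.1 hS)]
  simp_rw [h]
  rw [Finset.sum_comm]
  refine Finset.sum_congr rfl fun T _ => ?_
  rw [← Finset.sum_filter, Finset.sum_const, Finset.filter_univ_mem, nsmul_eq_mul, mul_assoc]

theorem sum_sum_notMem {α : Type*} [Fintype α] [DecidableEq α] (w : ℕ → ℝ)
    (f : Finset α → ℝ) :
    ∑ i : α, ∑ S ∈ ((Finset.univ : Finset α).erase i).powerset, w S.card * f S =
      ∑ T : Finset α, ((Fintype.card α - T.card : ℕ) : ℝ) * w T.card * f T := by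
  have h (i : α) :
      ∑ S ∈ ((Finset.univ : Finset α).erase i).powerset, w S.card * f S =
        ∑ T : Finset α, if i ∈ Tᶜ then w T.card * f T else 0 := by
    rw [← Finset.sum_filter]
    refine Finset.sum_congr ?_ fun _ _ => rfl
    ext S
    rw [mem_powerset_univ_erase]
    simp
  simp_rw [h]
  rw [Finset.sum_comm]
  refine Finset.sum_congr rfl fun T _ => ?_
  rw [← Finset.sum_filter, Finset.sum_const, Finset.filter_univ_mem, nsmul_eq_mul,
    Finset.card_compl, mul_assoc]

theorem shapleyValue_efficient {N : ℕ} (v : Game N) :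
    ∑ i : Fin N, shapleyValue v i = v.1 Finset.univ := by
  set w : ℕ → ℝ := fun k => ((k.factorial : ℝ) * ((N - 1 - k).factorial : ℝ)) / (N.factorial : ℝ)
    with hw
  have hsplit : ∑ i : Fin N, shapleyValue v i =
      ∑ T : Finset (Fin N), ((T.card : ℝ) * w (T.card - 1) * v.1 T -
        ((N - T.card : ℕ) : ℝ) * w T.card * v.1 T) := by
    have h₁ := sum_sum_insert w v.1
    have h₂ := sum_sum_notMem w v.1
    rw [Fintype.card_fin] at h₂
    rw [Finset.sum_sub_distrib, ← h₁, ← h₂]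
    simp only [shapleyValue, mul_sub, Finset.sum_sub_distrib, hw]
  rw [hsplit, Finset.sum_eq_single Finset.univ]
  · rcases N with _ | n
    · simp [v.2]
    · have hn : (n.factorial : ℝ) ≠ 0 := by positivity
      have hn' : (n : ℝ) + 1 ≠ 0 := by positivity
      simp only [hw, Finset.card_univ, Fintype.card_fin, Nat.add_sub_cancel, Nat.sub_self,
        Nat.factorial_succ, Nat.factorial_zero]
      push_cast
      field_simp
      ring
  · intro T _ hT
    rcases T.eq_empty_or_nonempty with rfl | hne
    · simp [v.2]
    · have hlt : T.card < N := by
        simpa using Finset.card_lt_card (Finset.ssubset_univ_iff.2 hT)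
      obtain ⟨k, hk⟩ := Nat.exists_eq_succ_of_ne_zero hne.card_pos.ne'
      obtain ⟨m, hm⟩ := Nat.exists_eq_add_of_lt hlt
      have e₁ : N - 1 - (T.card - 1) = m + 1 := by omega
      have e₂ : N - 1 - T.card = m := by omega
      have e₃ : N - T.card = m + 1 := by omega
      simp only [hw, e₁, e₂, e₃]
      simp only [hk, Nat.succ_eq_add_one, Nat.add_sub_cancel, Nat.factorial_succ k,
        Nat.factorial_succ m]
      push_cast
      ring
  · simp

theorem shapleyValue_symmetric {N : ℕ} (v : Game N) (i j : Fin N)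
    (h : ∀ S : Finset (Fin N), i ∉ S → j ∉ S → v.1 (insert i S) = v.1 (insert j S)) :
    shapleyValue v i = shapleyValue v j := by
  rcases eq_or_ne i j with rfl | hij
  · rfl
  refine Finset.sum_nbij' (fun S => if j ∈ S then insert i (S.erase j) else S)
    (fun S => if i ∈ S then insert j (S.erase i) else S) ?_ ?_ ?_ ?_ ?_
  · intro S hS
    rw [mem_powerset_univ_erase] at hS ⊢
    split_ifs <;> simp_all [hij.symm]
  · intro S hS
    rw [mem_powerset_univ_erase] at hS ⊢
    split_ifs <;> simp_all
  · intro S hS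
    rw [mem_powerset_univ_erase] at hS
    by_cases hj : j ∈ S <;> simp [hj, hS, Finset.insert_erase]
  · intro S hS
    rw [mem_powerset_univ_erase] at hS
    by_cases hi : i ∈ S <;> simp [hi, hS, Finset.insert_erase]
  · intro S hS
    rw [mem_powerset_univ_erase] at hS
    by_cases hj : j ∈ S
    · obtain ⟨R, hR, rfl⟩ : ∃ R, j ∉ R ∧ insert j R = S :=
        ⟨S.erase j, Finset.notMem_erase j S, Finset.insert_erase hj⟩
      have hiR : i ∉ R := fun hi => hS (Finset.mem_insert_of_mem hi)
      simp only [Finset.mem_insert_self, if_true, Finset.erase_insert hR,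
        Finset.card_insert_of_notMem hR, Finset.card_insert_of_notMem hiR]
      rw [Finset.insert_comm, h R hiR hR]
    · simp only [hj, if_false, h S hS hj]

theorem shapleyAxioms_shapleyValue {N : ℕ} :
    ShapleyAxioms (shapleyValue : Game N → Fin N → ℝ) := by
  refine ⟨shapleyValue_efficient, shapleyValue_symmetric, ?_, ?_⟩
  · intro v i h
    refine Finset.sum_eq_zero fun S hS => ?_
    rw [h S (mem_powerset_univ_erase.1 hS), mul_zero]
  · intro a b v w i
    simp only [shapleyValue, gameLC, Finset.mul_sum, ← Finset.sum_add_distrib]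
    refine Finset.sum_congr rfl fun S _ => ?_
    ring

/-- The game obtained from a set function by resetting its value at `∅` to `0`. -/
def gameOfFun {N : ℕ} (f : Finset (Fin N) → ℝ) : Game N :=
  ⟨fun S => if S = ∅ then 0 else f S, if_pos rfl⟩

theorem gameOfFun_val {N : ℕ} (v : Game N) : gameOfFun v.1 = v := by
  refine Subtype.ext (funext fun S => ?_)
  by_cases hS : S = ∅ <;> simp [gameOfFun, hS, v.2]

theorem gameOfFun_linearCombination {N : ℕ} (a b : ℝ) (f g : Finset (Fin N) → ℝ) :
    gameOfFun (a • f + b • g) = gameLC a b (gameOfFun f) (gameOfFun g) := by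
  refine Subtype.ext (funext fun S => ?_)
  by_cases hS : S = ∅ <;> simp [gameOfFun, gameLC, hS]

/-- The payoff of player `i` as a linear functional on set functions. -/
def ShapleyAxioms.payoff {N : ℕ} {φ : Game N → Fin N → ℝ} (h : ShapleyAxioms φ) (i : Fin N) :
    (Finset (Fin N) → ℝ) →ₗ[ℝ] ℝ where
  toFun f := φ (gameOfFun f) i
  map_add' f g := by
    simpa [← gameOfFun_linearCombination] using h.2.2.2 1 1 (gameOfFun f) (gameOfFun g) i
  map_smul' a f := by
    simpa [← gameOfFun_linearCombination] using h.2.2.2 a 0 (gameOfFun f) (gameOfFun f) i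

/-- The unanimity function of the coalition `T`. -/
def unanimity {N : ℕ} (T : Finset (Fin N)) : Finset (Fin N) → ℝ :=
  fun S => if T ⊆ S then 1 else 0

theorem ShapleyAxioms.payoff_unanimity {N : ℕ} {φ : Game N → Fin N → ℝ} (h : ShapleyAxioms φ)
    (i : Fin N) {T : Finset (Fin N)} (hT : T.Nonempty) :
    h.payoff i (unanimity T) = if i ∈ T then (T.card : ℝ)⁻¹ else 0 := by
  have hval (S : Finset (Fin N)) :
      (gameOfFun (unanimity T)).1 S = if T ⊆ S then 1 else 0 := by
    by_cases hS : S = ∅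
    · simp [gameOfFun, hS, hT.ne_empty]
    · simp [gameOfFun, unanimity, hS]
  have hnull (j : Fin N) (hj : j ∉ T) : φ (gameOfFun (unanimity T)) j = 0 := by
    refine h.2.2.1 _ j fun S _ => ?_
    simp [hval, Finset.subset_insert_iff_of_notMem hj]
  have hsymm (j k : Fin N) (hj : j ∈ T) (hk : k ∈ T) :
      φ (gameOfFun (unanimity T)) j = φ (gameOfFun (unanimity T)) k := by
    refine h.2.1 _ j k fun S hjS hkS => ?_
    rcases eq_or_ne j k with rfl | hjk
    · rfl
    rw [hval, hval, if_neg, if_neg]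
    · exact fun hsub => (Finset.mem_insert.1 (hsub hj)).elim hjk hjS
    · exact fun hsub => (Finset.mem_insert.1 (hsub hk)).elim hjk.symm hkS
  change φ (gameOfFun (unanimity T)) i = _
  split_ifs with hi
  · have heff := h.1 (gameOfFun (unanimity T))
    rw [hval, if_pos (Finset.subset_univ T),
      ← Finset.sum_subset (Finset.subset_univ T) fun j _ hj => hnull j hj,
      Finset.sum_congr rfl fun j hj => hsymm j i hj hi, Finset.sum_const, nsmul_eq_mul] at heff
    exact eq_inv_of_mul_eq_one_right heff
  · exact hnull i hi

theorem unanimity_eq_sum_single {N : ℕ} (T : Finset (Fin N)) :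
    unanimity T = Pi.single T 1 + ∑ S with T ⊂ S, Pi.single S (1 : ℝ) := by
  funext R
  simp only [unanimity, Pi.add_apply, Finset.sum_apply, Pi.single_apply, Finset.sum_ite_eq,
    Finset.mem_filter, Finset.mem_univ, true_and]
  rcases eq_or_ne R T with rfl | hne
  · simp
  · simp [hne, Finset.ssubset_iff_subset_ne, hne.symm]

theorem ShapleyAxioms.payoff_single_eq {N : ℕ} {φ ψ : Game N → Fin N → ℝ} (hφ : ShapleyAxioms φ)
    (hψ : ShapleyAxioms ψ) (i : Fin N) (T : Finset (Fin N)) :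
    hφ.payoff i (Pi.single T 1) = hψ.payoff i (Pi.single T 1) := by
  induction T using WellFoundedGT.induction with
  | ind T ih =>
    rcases T.eq_empty_or_nonempty with rfl | hT
    · have hzero : gameOfFun (Pi.single (∅ : Finset (Fin N)) (1 : ℝ)) = gameOfFun 0 := by
        refine Subtype.ext (funext fun S => ?_)
        by_cases hS : S = ∅ <;> simp [gameOfFun, hS]
      have key {χ : Game N → Fin N → ℝ} (hχ : ShapleyAxioms χ) :
          hχ.payoff i (Pi.single ∅ 1) = 0 := by
        rw [← map_zero (hχ.payoff i)]
        exact congrArg (χ · i) hzero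
      rw [key hφ, key hψ]
    · have heq := (hφ.payoff_unanimity i hT).trans (hψ.payoff_unanimity i hT).symm
      rw [unanimity_eq_sum_single, map_add, map_add, map_sum, map_sum,
        Finset.sum_congr rfl fun S hS => ih S (Finset.mem_filter.1 hS).2] at heq
      exact add_right_cancel heq

theorem ShapleyAxioms.unique {N : ℕ} {φ ψ : Game N → Fin N → ℝ} (hφ : ShapleyAxioms φ)
    (hψ : ShapleyAxioms ψ) : φ = ψ := by
  funext v i
  have hpayoff : hφ.payoff i = hψ.payoff i :=
    LinearMap.pi_ext' fun T => LinearMap.ext_ring (hφ.payoff_single_eq hψ i T)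
  have hv : φ (gameOfFun v.1) i = ψ (gameOfFun v.1) i := LinearMap.congr_fun hpayoff v.1
  rwa [gameOfFun_val] at hv

/-- Shapley's theorem: there is a unique allocation satisfying the Shapley axioms,
and it is given by the explicit Shapley formula. -/
theorem shapley_existence_uniqueness_and_formula (N : ℕ) :
    (∃! φ : Game N → Fin N → ℝ, ShapleyAxioms φ) ∧
    (∀ φ : Game N → Fin N → ℝ, ShapleyAxioms φ → ∀ (v : Game N) (i : Fin N),
      φ v i = ∑ S ∈ ((Finset.univ : Finset (Fin N)).erase i).powerset,
        ((S.card.factorial : ℝ) * ((N - 1 - S.card).factorial : ℝ)) / (N.factorial : ℝ) *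
          (v.1 (insert i S) - v.1 S)) := by
  exact ⟨⟨shapleyValue, shapleyAxioms_shapleyValue, fun _ h => h.unique shapleyAxioms_shapleyValue⟩,
    fun _ h v i => congrFun (congrFun (h.unique shapleyAxioms_shapleyValue) v) i⟩
end

section
/- There exists a unique allocation v ∈ 𝒢 ↦ (Φ_i[v])_{i∈ℕ} satisfying axioms A1 (efficiency), A2 (symmetry), A3 (null-player), A4 (linearity), and A5 (reflection). -/
open Finset

/-- The game `v^{ij}`, in which the contributions of players `i` and `j` are interchanged:
`v^{ij}(S) = v(S^{ij})`, where `S^{ij}` is the image of `S` under the transposition of `i,j`. -/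
def swapGame {N : ℕ} (i j : Fin N) (v : Game N) : Game N :=
  ⟨fun S => v.1 (S.image (Equiv.swap i j)), by simp [v.2]⟩

/-- The restricted game `v_{-i}` on the player set `[N] \ {i}`, identified with
`Fin n` (where `N = n+1`) via the order-preserving bijection `Fin.succAbove i`. -/
def restrictGame {n : ℕ} (i : Fin (n + 1)) (v : Game (n + 1)) : Game n :=
  ⟨fun S => v.1 (S.image i.succAbove), by simp [v.2]⟩

/-- The axioms A1--A5 for an allocation `v ∈ 𝒢 ↦ (Φ_i[v])_{i ∈ ℕ}`:
each `Φ_i[v]` is a game in `𝒢_N`, `Φ_i[v] ≡ 0` for players `i` beyond `[N]`, and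
A1 (efficiency), A2 (symmetry), A3 (null-player), A4 (linearity), A5 (reflection) hold. -/
def IsHodgeAllocation (Φ : (N : ℕ) → Game N → ℕ → Finset (Fin N) → ℝ) : Prop :=
  -- each Φ_i[v] belongs to 𝒢_N
  (∀ (N : ℕ) (v : Game N) (k : ℕ), Φ N v k ∅ = 0) ∧
  -- Φ_i[v] ≡ 0 for players beyond [N]
  (∀ (N : ℕ) (v : Game N) (k : ℕ), N ≤ k → ∀ S : Finset (Fin N), Φ N v k S = 0) ∧
  -- A1 (efficiency): v = ∑_i Φ_i[v]
  (∀ (N : ℕ) (v : Game N) (S : Finset (Fin N)), v.1 S = ∑ i : Fin N, Φ N v i.1 S) ∧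
  -- A2 (symmetry): Φ_i[v^{ij}](S^{ij}) = Φ_j[v](S)
  (∀ (N : ℕ) (v : Game N) (i j : Fin N) (S : Finset (Fin N)),
    Φ N (swapGame i j v) i.1 (S.image (Equiv.swap i j)) = Φ N v j.1 S) ∧
  -- A3 (null-player): if d_i v = 0 then Φ_i[v] ≡ 0 and
  -- Φ_j[v](S ∪ {i}) = Φ_j[v](S) = Φ_j[v_{-i}](S) for j ≠ i, S ⊆ [N] \ {i}
  (∀ (n : ℕ) (v : Game (n + 1)) (i : Fin (n + 1)),
    (∀ S : Finset (Fin (n + 1)), i ∉ S → v.1 (insert i S) = v.1 S) →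
    (∀ S : Finset (Fin (n + 1)), Φ (n + 1) v i.1 S = 0) ∧
    (∀ (j : Fin n) (S : Finset (Fin n)),
      Φ (n + 1) v (i.succAbove j).1 (insert i (S.image i.succAbove))
        = Φ (n + 1) v (i.succAbove j).1 (S.image i.succAbove) ∧
      Φ (n + 1) v (i.succAbove j).1 (S.image i.succAbove)
        = Φ n (restrictGame i v) j.1 S)) ∧
  -- A4 (linearity)
  (∀ (N : ℕ) (a b : ℝ) (v w : Game N) (k : ℕ) (S : Finset (Fin N)),
    Φ N (gameLC a b v w) k S = a * Φ N v k S + b * Φ N w k S) ∧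
  -- A5 (reflection)
  (∀ (N : ℕ) (v : Game N) (i : Fin N) (S T : Finset (Fin N)), i ∉ S → i ∉ T →
    Φ N v i.1 (insert i S) - Φ N v i.1 (insert i T) = -(Φ N v i.1 S - Φ N v i.1 T))

/-- The Walsh function `S ↦ (-1) ^ #(T ∩ S)` on the hypercube. -/
noncomputable def walsh {N : ℕ} (T S : Finset (Fin N)) : ℝ :=
  ∏ i ∈ T, if i ∈ S then -1 else 1

/-- The Walsh coefficient of `f` at `T`. -/
noncomputable def walshCoeff {N : ℕ} (f : Finset (Fin N) → ℝ) (T : Finset (Fin N)) : ℝ :=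
  (∑ U, f U * walsh T U) / 2 ^ N

@[simp]
lemma walsh_empty_right {N : ℕ} (T : Finset (Fin N)) : walsh T ∅ = 1 := by
  simp [walsh]

lemma walsh_insert_of_mem {N : ℕ} {T S : Finset (Fin N)} {i : Fin N} (hT : i ∈ T) (hS : i ∉ S) :
    walsh T (insert i S) = -walsh T S := by
  unfold walsh
  rw [← mul_prod_erase T _ hT, ← mul_prod_erase T _ hT]
  have h : ∏ x ∈ T.erase i, (if x ∈ insert i S then (-1 : ℝ) else 1)
      = ∏ x ∈ T.erase i, if x ∈ S then (-1 : ℝ) else 1 :=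
    prod_congr rfl fun x hx => by simp [ne_of_mem_erase hx]
  rw [h]
  simp [hS]

lemma walsh_insert_of_notMem {N : ℕ} {T : Finset (Fin N)} {i : Fin N} (hT : i ∉ T)
    (S : Finset (Fin N)) : walsh T (insert i S) = walsh T S :=
  prod_congr rfl fun x hx => by simp [show x ≠ i from fun h => hT (h ▸ hx)]

lemma walsh_image {M N : ℕ} {g : Fin M → Fin N} (hg : Function.Injective g)
    (T S : Finset (Fin M)) : walsh (T.image g) (S.image g) = walsh T S := by
  unfold walsh
  rw [prod_image hg.injOn]
  simp [hg.eq_iff]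

lemma sum_walsh_mul_walsh {N : ℕ} (S U : Finset (Fin N)) :
    ∑ T, walsh T U * walsh T S = if U = S then 2 ^ N else 0 := by
  have h := prod_one_add (R := ℝ) (s := (univ : Finset (Fin N)))
    (f := fun i => (if i ∈ U then (-1 : ℝ) else 1) * if i ∈ S then -1 else 1)
  rw [powerset_univ] at h
  simp only [walsh, ← prod_mul_distrib]
  rw [← h]
  split_ifs with hUS
  · subst hUS
    rw [prod_congr rfl (g := fun _ => (2 : ℝ)) fun i _ => by split_ifs <;> norm_num]
    simp
  · obtain ⟨i, hi⟩ : ∃ i, ¬(i ∈ U ↔ i ∈ S) := by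
      by_contra! hc
      exact hUS (Finset.ext hc)
    refine prod_eq_zero (mem_univ i) ?_
    by_cases h1 : i ∈ U <;> by_cases h2 : i ∈ S <;> simp_all

lemma sum_walshCoeff_mul_walsh {N : ℕ} (f : Finset (Fin N) → ℝ) (S : Finset (Fin N)) :
    ∑ T, walshCoeff f T * walsh T S = f S := by
  calc ∑ T, walshCoeff f T * walsh T S
      = (∑ U, f U * ∑ T, walsh T U * walsh T S) / 2 ^ N := by
        simp only [walshCoeff, div_mul_eq_mul_div, ← sum_div, sum_mul, mul_sum]
        rw [sum_comm]
        simp only [mul_assoc]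
    _ = f S := by simp [sum_walsh_mul_walsh]

/-- A sum over coalitions splits according to the membership of a given player. -/
lemma sum_finset_succAbove {n : ℕ} (i : Fin (n + 1)) (F : Finset (Fin (n + 1)) → ℝ) :
    ∑ T, F T = ∑ T : Finset (Fin n),
      (F (T.image i.succAbove) + F (insert i (T.image i.succAbove))) := by
  have hi : i ∉ (univ : Finset (Fin n)).image i.succAbove := by simp
  have hu : (univ : Finset (Fin (n + 1))) = insert i (univ.image i.succAbove) := by
    ext x
    rcases Fin.eq_self_or_eq_succAbove i x with h | ⟨y, h⟩ <;> simp [h]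
  have hp : ∀ G : Finset (Fin (n + 1)) → ℝ,
      ∑ T ∈ (univ.image i.succAbove).powerset, G T
        = ∑ T : Finset (Fin n), G (T.image i.succAbove) := fun G => by
    rw [powerset_image, sum_image (image_injective Fin.succAbove_right_injective).injOn,
      powerset_univ]
  rw [← powerset_univ, hu, sum_powerset_insert hi, hp, hp, sum_add_distrib]

lemma notMem_image_succAbove {n : ℕ} (i : Fin (n + 1)) (S : Finset (Fin n)) :
    i ∉ S.image i.succAbove := by
  simp

lemma exists_eq_image_succAbove {n : ℕ} {i : Fin (n + 1)} {S : Finset (Fin (n + 1))}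
    (hS : i ∉ S) : ∃ S' : Finset (Fin n), S = S'.image i.succAbove := by
  refine ⟨univ.filter fun j => i.succAbove j ∈ S, ?_⟩
  ext x
  rcases Fin.eq_self_or_eq_succAbove i x with h | ⟨y, h⟩ <;> simp [h, hS]

section NullPlayer

variable {n : ℕ} {i : Fin (n + 1)} {f : Finset (Fin (n + 1)) → ℝ}

lemma walshCoeff_eq_zero_of_null (hf : ∀ S, i ∉ S → f (insert i S) = f S)
    {T : Finset (Fin (n + 1))} (hT : i ∈ T) : walshCoeff f T = 0 := by
  rw [walshCoeff, sum_finset_succAbove i, sum_eq_zero, zero_div]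
  intro U _
  have hU := notMem_image_succAbove i U
  rw [hf _ hU, walsh_insert_of_mem hT hU]
  ring

lemma walshCoeff_image_succAbove_of_null (hf : ∀ S, i ∉ S → f (insert i S) = f S)
    (T : Finset (Fin n)) :
    walshCoeff f (T.image i.succAbove) = walshCoeff (fun S => f (S.image i.succAbove)) T := by
  have h : ∀ U : Finset (Fin n),
      f (U.image i.succAbove) * walsh (T.image i.succAbove) (U.image i.succAbove)
        + f (insert i (U.image i.succAbove))
          * walsh (T.image i.succAbove) (insert i (U.image i.succAbove))
        = 2 * (f (U.image i.succAbove) * walsh T U) := fun U => by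
    rw [hf _ (notMem_image_succAbove i U), walsh_insert_of_notMem (notMem_image_succAbove i T),
      walsh_image Fin.succAbove_right_injective]
    ring
  rw [walshCoeff, walshCoeff, sum_finset_succAbove i, sum_congr rfl fun U _ => h U, ← mul_sum,
    pow_succ]
  field_simp

end NullPlayer

lemma sum_image_swap {N : ℕ} (i j : Fin N) (F : Finset (Fin N) → ℝ) :
    ∑ T : Finset (Fin N), F (T.image (Equiv.swap i j)) = ∑ T, F T :=
  Function.Bijective.sum_comp
    (Function.Involutive.bijective (f := fun T : Finset (Fin N) => T.image (Equiv.swap i j))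
      fun T => by simp [image_image, Function.comp_def]) F

lemma walshCoeff_image_swap {N : ℕ} (i j : Fin N) (f : Finset (Fin N) → ℝ)
    (T : Finset (Fin N)) :
    walshCoeff f (T.image (Equiv.swap i j))
      = walshCoeff (fun S => f (S.image (Equiv.swap i j))) T := by
  rw [walshCoeff, walshCoeff, ← sum_image_swap i j]
  simp only [walsh_image (Equiv.swap i j).injective]

/-- The Hodge allocation: the component of the game along the Walsh function of `T` is shared
equally among the members of `T`. -/
noncomputable def hodgeAllocation (N : ℕ) (v : Game N) (k : ℕ) (S : Finset (Fin N)) : ℝ :=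
  ∑ T : Finset (Fin N),
    if k ∈ T.image Fin.val then walshCoeff v.1 T / #T * (walsh T S - 1) else 0

lemma hodgeAllocation_fin {N : ℕ} (v : Game N) (i : Fin N) (S : Finset (Fin N)) :
    hodgeAllocation N v i.1 S
      = ∑ T : Finset (Fin N), if i ∈ T then walshCoeff v.1 T / #T * (walsh T S - 1) else 0 :=
  sum_congr rfl fun T _ => by simp [Fin.val_inj]

lemma sum_hodgeAllocation {N : ℕ} (v : Game N) (S : Finset (Fin N)) :
    v.1 S = ∑ i : Fin N, hodgeAllocation N v i.1 S := by
  simp only [hodgeAllocation_fin]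
  rw [sum_comm]
  have h : ∀ T : Finset (Fin N),
      (∑ i : Fin N, if i ∈ T then walshCoeff v.1 T / #T * (walsh T S - 1) else 0)
        = walshCoeff v.1 T * walsh T S - walshCoeff v.1 T * walsh T ∅ := fun T => by
    rw [sum_ite_mem, univ_inter, sum_const, nsmul_eq_mul, walsh_empty_right]
    rcases T.eq_empty_or_nonempty with rfl | hT
    · simp [walsh]
    · have : (#T : ℝ) ≠ 0 := by exact_mod_cast hT.card_ne_zero
      field_simp
  rw [sum_congr rfl fun T _ => h T, sum_sub_distrib, sum_walshCoeff_mul_walsh,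
    sum_walshCoeff_mul_walsh, v.2, sub_zero]

lemma hodgeAllocation_swapGame {N : ℕ} (v : Game N) (i j : Fin N) (S : Finset (Fin N)) :
    hodgeAllocation N (swapGame i j v) i.1 (S.image (Equiv.swap i j))
      = hodgeAllocation N v j.1 S := by
  rw [hodgeAllocation_fin, hodgeAllocation_fin, ← sum_image_swap i j]
  refine sum_congr rfl fun T _ => ?_
  have hmem : i ∈ T.image (Equiv.swap i j) ↔ j ∈ T := by
    rw [← (Equiv.swap i j).injective.mem_finset_image (s := T), Equiv.swap_apply_right]
  have hc : walshCoeff (swapGame i j v).1 (T.image (Equiv.swap i j)) = walshCoeff v.1 T := by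
    rw [swapGame, ← walshCoeff_image_swap, image_image]
    simp [Function.comp_def]
  rw [hc, walsh_image (Equiv.swap i j).injective,
    card_image_of_injective _ (Equiv.swap i j).injective]
  simp only [hmem]

lemma hodgeAllocation_null {n : ℕ} (v : Game (n + 1)) (i : Fin (n + 1))
    (hv : ∀ S, i ∉ S → v.1 (insert i S) = v.1 S) (S : Finset (Fin (n + 1))) :
    hodgeAllocation (n + 1) v i.1 S = 0 := by
  rw [hodgeAllocation_fin]
  refine sum_eq_zero fun T _ => ?_
  split_ifs with hT
  · simp [walshCoeff_eq_zero_of_null hv hT]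
  · rfl

lemma hodgeAllocation_insert_null {n : ℕ} (v : Game (n + 1)) (i : Fin (n + 1))
    (hv : ∀ S, i ∉ S → v.1 (insert i S) = v.1 S) (k : ℕ) (S : Finset (Fin (n + 1))) :
    hodgeAllocation (n + 1) v k (insert i S) = hodgeAllocation (n + 1) v k S := by
  refine sum_congr rfl fun T _ => ?_
  by_cases hT : i ∈ T
  · simp [walshCoeff_eq_zero_of_null hv hT]
  · rw [walsh_insert_of_notMem hT]

lemma hodgeAllocation_restrictGame {n : ℕ} (v : Game (n + 1)) (i : Fin (n + 1))
    (hv : ∀ S, i ∉ S → v.1 (insert i S) = v.1 S) (j : Fin n) (S : Finset (Fin n)) :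
    hodgeAllocation (n + 1) v (i.succAbove j).1 (S.image i.succAbove)
      = hodgeAllocation n (restrictGame i v) j.1 S := by
  rw [hodgeAllocation_fin, hodgeAllocation_fin, sum_finset_succAbove i]
  refine sum_congr rfl fun T _ => ?_
  have hinj := Fin.succAbove_right_injective (p := i)
  rw [walshCoeff_eq_zero_of_null hv (mem_insert_self i _), walshCoeff_image_succAbove_of_null hv,
    walsh_image hinj, card_image_of_injective _ hinj]
  simp [restrictGame]

lemma hodgeAllocation_gameLC {N : ℕ} (a b : ℝ) (v w : Game N) (k : ℕ) (S : Finset (Fin N)) :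
    hodgeAllocation N (gameLC a b v w) k S
      = a * hodgeAllocation N v k S + b * hodgeAllocation N w k S := by
  have hc : ∀ T, walshCoeff (gameLC a b v w).1 T
      = a * walshCoeff v.1 T + b * walshCoeff w.1 T := fun T => by
    simp only [walshCoeff, gameLC, add_mul, sum_add_distrib, mul_assoc, ← mul_sum]
    ring
  simp only [hodgeAllocation, mul_sum, ← sum_add_distrib, hc]
  refine sum_congr rfl fun T _ => ?_
  split_ifs <;> ring

lemma hodgeAllocation_reflection {N : ℕ} (v : Game N) (i : Fin N) (S T : Finset (Fin N))
    (hS : i ∉ S) (hT : i ∉ T) :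
    hodgeAllocation N v i.1 (insert i S) - hodgeAllocation N v i.1 (insert i T)
      = -(hodgeAllocation N v i.1 S - hodgeAllocation N v i.1 T) := by
  simp only [hodgeAllocation_fin, ← sum_sub_distrib, ← sum_neg_distrib]
  refine sum_congr rfl fun U _ => ?_
  split_ifs with hU
  · rw [walsh_insert_of_mem hU hS, walsh_insert_of_mem hU hT]
    ring
  · simp

lemma isHodgeAllocation_hodgeAllocation : IsHodgeAllocation hodgeAllocation := by
  refine ⟨fun N v k => by simp [hodgeAllocation], fun N v k hk S => ?_,
    fun N => sum_hodgeAllocation, fun N => hodgeAllocation_swapGame, fun n v i hv =>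
      ⟨hodgeAllocation_null v i hv, fun j S => ⟨hodgeAllocation_insert_null v i hv _ _,
        hodgeAllocation_restrictGame v i hv j S⟩⟩,
    fun N => hodgeAllocation_gameLC, fun N => hodgeAllocation_reflection⟩
  refine sum_eq_zero fun T _ => if_neg ?_
  simp only [mem_image, not_exists, not_and]
  intro x _ hx
  omega

/-- A symmetric family of games satisfying the reflection identity and summing to zero
vanishes. -/
lemma eq_zero_of_symmetric_of_reflection {N : ℕ} (D : Fin N → Finset (Fin N) → ℝ)
    (hempty : ∀ i, D i ∅ = 0) (hsum : ∀ S, ∑ i, D i S = 0)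
    (hsymm : ∀ i j S, D i (S.image (Equiv.swap i j)) = D j S)
    (hrefl : ∀ i S T, i ∉ S → i ∉ T → D i (insert i S) - D i (insert i T) = -(D i S - D i T))
    (i : Fin N) (S : Finset (Fin N)) : D i S = 0 := by
  set c := D i {i} with hc
  have hsingle : ∀ j, D j {j} = c := fun j => by
    rw [hc, ← hsymm i j {j}]
    simp
  have hmem : ∀ j S, j ∈ S → D j S = c - D j (S.erase j) := fun j S hj => by
    have h := hrefl j (S.erase j) ∅ (notMem_erase j S) (notMem_empty j)
    rw [insert_erase hj, hempty, insert_empty, hsingle] at h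
    linarith
  have key : ∀ s : ℕ, ∃ a : ℝ, a ≤ 0 ∧ ∀ S, #S = s → ∀ j ∉ S, D j S = c * a := by
    intro s
    induction s with
    | zero =>
      refine ⟨0, le_rfl, fun S hS j _ => ?_⟩
      rw [card_eq_zero.1 hS, hempty, mul_zero]
    | succ s ih =>
      obtain ⟨a, ha, h⟩ := ih
      refine ⟨-(((s : ℝ) + 1) * (1 - a)) / ((N - (s + 1) : ℕ) : ℝ),
        div_nonpos_of_nonpos_of_nonneg (neg_nonpos.2 (mul_nonneg (by positivity) (by linarith)))
          (Nat.cast_nonneg _), fun S hS j hj => ?_⟩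
      have hin : ∀ l ∈ S, D l S = c - c * a := fun l hl => by
        rw [hmem l S hl, h _ (by rw [card_erase_of_mem hl, hS]; rfl) l (notMem_erase l S)]
      have hout : ∀ l ∈ Sᶜ, D l S = D j S := fun l hl => by
        rw [mem_compl] at hl
        rw [← hsymm l j S]
        congr 1
        rw [image_congr (g := id), image_id]
        intro x hx
        exact Equiv.swap_apply_of_ne_of_ne (fun e => hl (e ▸ hx)) (fun e => hj (e ▸ hx))
      have hcard : #Sᶜ = N - (s + 1) := by rw [card_compl, hS, Fintype.card_fin]
      have hpos : ((N - (s + 1) : ℕ) : ℝ) ≠ 0 := by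
        rw [← hcard]
        exact_mod_cast card_ne_zero_of_mem (mem_compl.2 hj)
      have h0 := hsum S
      rw [← sum_add_sum_compl S, sum_congr rfl hin, sum_congr rfl hout, sum_const, sum_const,
        hcard, hS, nsmul_eq_mul, nsmul_eq_mul] at h0
      push_cast at h0
      rw [mul_div_assoc', eq_div_iff hpos]
      linarith
  have hc0 : c = 0 := by
    obtain ⟨a, ha, h⟩ := key (N - 1)
    have h0 := hsum univ
    rw [sum_congr rfl (g := fun _ => c - c * a) fun l _ => by
      rw [hmem l univ (mem_univ l), h _ (by simp) l (notMem_erase l _)]] at h0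
    rw [sum_const, nsmul_eq_mul, card_univ, Fintype.card_fin] at h0
    have hN : (N : ℝ) ≠ 0 := by exact_mod_cast i.pos.ne'
    have h1 : c * (1 - a) = 0 := by
      linarith [(mul_eq_zero.1 h0).resolve_left hN]
    exact (mul_eq_zero.1 h1).resolve_right (by linarith)
  have hzero : ∀ j S, j ∉ S → D j S = 0 := fun j S hj => by
    obtain ⟨a, -, h⟩ := key #S
    rw [h S rfl j hj, hc0, zero_mul]
  by_cases hi : i ∈ S
  · rw [hmem i S hi, hc0, hzero i _ (notMem_erase i S), sub_zero]
  · exact hzero i S hi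

/-- The game obtained from a function on coalitions by subtracting its value at `∅`. -/
def toGame {N : ℕ} (f : Finset (Fin N) → ℝ) : Game N :=
  ⟨fun S => f S - f ∅, sub_self _⟩

lemma toGame_val {N : ℕ} (v : Game N) : toGame v.1 = v :=
  Subtype.ext (funext fun S => by simp [toGame, v.2])

/-- An allocation as a linear functional of the underlying function on coalitions. -/
def IsHodgeAllocation.toLinearMap {Φ : (N : ℕ) → Game N → ℕ → Finset (Fin N) → ℝ}
    (hΦ : IsHodgeAllocation Φ) {N : ℕ} (k : ℕ) (S : Finset (Fin N)) :
    (Finset (Fin N) → ℝ) →ₗ[ℝ] ℝ where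
  toFun f := Φ N (toGame f) k S
  map_add' f g := by
    obtain ⟨-, -, -, -, -, hlin, -⟩ := hΦ
    have h : toGame (f + g) = gameLC 1 1 (toGame f) (toGame g) :=
      Subtype.ext (funext fun S => by simp only [toGame, gameLC, Pi.add_apply]; ring)
    rw [h, hlin]
    ring
  map_smul' a f := by
    obtain ⟨-, -, -, -, -, hlin, -⟩ := hΦ
    have h : toGame (a • f) = gameLC a 0 (toGame f) (toGame f) :=
      Subtype.ext (funext fun S => by
        simp only [toGame, gameLC, Pi.smul_apply, smul_eq_mul]; ring)
    rw [h, hlin]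
    simp

/-- Two allocations agreeing on all Walsh functions agree. -/
lemma IsHodgeAllocation.eq_of_walsh {Φ Ψ : (N : ℕ) → Game N → ℕ → Finset (Fin N) → ℝ}
    (hΦ : IsHodgeAllocation Φ) (hΨ : IsHodgeAllocation Ψ) {N : ℕ} {k : ℕ} {S : Finset (Fin N)}
    (h : ∀ T, Φ N (toGame (walsh T)) k S = Ψ N (toGame (walsh T)) k S) (v : Game N) :
    Φ N v k S = Ψ N v k S := by
  have hv : v.1 = ∑ T, walshCoeff v.1 T • walsh T := funext fun U => by
    simp [sum_walshCoeff_mul_walsh]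
  have key : hΦ.toLinearMap k S v.1 = hΨ.toLinearMap k S v.1 := by
    rw [hv, map_sum, map_sum]
    refine sum_congr rfl fun T _ => ?_
    rw [map_smul, map_smul]
    exact congrArg _ (h T)
  have key' : Φ N (toGame v.1) k S = Ψ N (toGame v.1) k S := key
  rwa [toGame_val] at key'

lemma swapGame_toGame_walsh_univ {N : ℕ} (i j : Fin N) :
    swapGame i j (toGame (walsh univ)) = toGame (walsh univ) := by
  refine Subtype.ext (funext fun S => ?_)
  have h := walsh_image (Equiv.swap i j).injective univ S
  rw [image_univ_equiv] at h
  simp only [swapGame, toGame, h]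

/-- Two allocations agree on the Walsh function of the grand coalition. -/
lemma IsHodgeAllocation.eq_walsh_univ {Φ Ψ : (N : ℕ) → Game N → ℕ → Finset (Fin N) → ℝ}
    (hΦ : IsHodgeAllocation Φ) (hΨ : IsHodgeAllocation Ψ) {N : ℕ} (i : Fin N)
    (S : Finset (Fin N)) :
    Φ N (toGame (walsh univ)) i.1 S = Ψ N (toGame (walsh univ)) i.1 S := by
  obtain ⟨hΦ0, -, hΦsum, hΦsymm, -, -, hΦrefl⟩ := hΦ
  obtain ⟨hΨ0, -, hΨsum, hΨsymm, -, -, hΨrefl⟩ := hΨ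
  refine sub_eq_zero.1 (eq_zero_of_symmetric_of_reflection
    (fun i S => Φ N (toGame (walsh univ)) i.1 S - Ψ N (toGame (walsh univ)) i.1 S)
    (fun i => by simp [hΦ0, hΨ0]) (fun S => ?_) (fun i j S => ?_) (fun i S T hS hT => ?_) i S)
  · rw [sum_sub_distrib, ← hΦsum, ← hΨsum, sub_self]
  · have h1 := hΦsymm N (toGame (walsh univ)) i j S
    have h2 := hΨsymm N (toGame (walsh univ)) i j S
    rw [swapGame_toGame_walsh_univ] at h1 h2
    simp only [h1, h2]
  · have h1 := hΦrefl N (toGame (walsh univ)) i S T hS hT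
    have h2 := hΨrefl N (toGame (walsh univ)) i S T hS hT
    linarith

/-- Two allocations agreeing on games with `n` players agree on games with `n + 1` players one of
which is null. -/
lemma IsHodgeAllocation.eq_of_null {Φ Ψ : (N : ℕ) → Game N → ℕ → Finset (Fin N) → ℝ}
    (hΦ : IsHodgeAllocation Φ) (hΨ : IsHodgeAllocation Ψ) {n : ℕ} (h : Φ n = Ψ n)
    {v : Game (n + 1)} {i : Fin (n + 1)} (hv : ∀ S, i ∉ S → v.1 (insert i S) = v.1 S)
    (l : Fin (n + 1)) (S : Finset (Fin (n + 1))) :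
    Φ (n + 1) v l.1 S = Ψ (n + 1) v l.1 S := by
  obtain ⟨-, -, -, -, hΦnull, -, -⟩ := hΦ
  obtain ⟨-, -, -, -, hΨnull, -, -⟩ := hΨ
  obtain ⟨hΦi, hΦj⟩ := hΦnull n v i hv
  obtain ⟨hΨi, hΨj⟩ := hΨnull n v i hv
  rcases Fin.eq_self_or_eq_succAbove i l with rfl | ⟨j, rfl⟩
  · rw [hΦi, hΨi]
  · by_cases hS : i ∈ S
    · obtain ⟨S', hS'⟩ := exists_eq_image_succAbove (notMem_erase i S)
      rw [← insert_erase hS, hS', (hΦj j S').1, (hΨj j S').1, (hΦj j S').2, (hΨj j S').2, h]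
    · obtain ⟨S', rfl⟩ := exists_eq_image_succAbove hS
      rw [(hΦj j S').2, (hΨj j S').2, h]

lemma IsHodgeAllocation.unique {Φ Ψ : (N : ℕ) → Game N → ℕ → Finset (Fin N) → ℝ}
    (hΦ : IsHodgeAllocation Φ) (hΨ : IsHodgeAllocation Ψ) : Φ = Ψ := by
  funext N
  induction N with
  | zero =>
    funext v k S
    rw [hΦ.2.1 0 v k k.zero_le, hΨ.2.1 0 v k k.zero_le]
  | succ n ih =>
    funext v k S
    by_cases hk : n + 1 ≤ k
    · rw [hΦ.2.1 _ v k hk, hΨ.2.1 _ v k hk]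
    lift k to Fin (n + 1) using not_le.1 hk
    refine hΦ.eq_of_walsh hΨ (fun T => ?_) v
    by_cases hT : T = univ
    · rw [hT]
      exact hΦ.eq_walsh_univ hΨ k S
    · obtain ⟨i, hi⟩ : ∃ i, i ∉ T := by
        by_contra! hc
        exact hT (eq_univ_of_forall hc)
      refine hΦ.eq_of_null hΨ ih (i := i) (fun U _ => ?_) k S
      simp only [toGame, walsh_insert_of_notMem hi]

/-- There exists a unique allocation satisfying the axioms A1--A5. -/
theorem exists_unique_hodge_allocation :
    ∃! Φ : (N : ℕ) → Game N → ℕ → Finset (Fin N) → ℝ, IsHodgeAllocation Φ :=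
  ⟨hodgeAllocation, isHodgeAllocation_hodgeAllocation,
    fun _ hΦ => hΦ.unique isHodgeAllocation_hodgeAllocation⟩
end

section
/- The Hodge-theoretic component games satisfy the axioms A1–A5: setting Φ_i[v] = v_i for v ∈ 𝒢_N and i ∈ [N] (and Φ_i[v] ≡ 0 for i ≥ N+1) defines an allocation satisfying efficiency, symmetry, null-player, linearity, and reflection. -/
open Finset

/-- The gradient `d`: `grad u S i = du(S, S ∪ {i}) = u(S ∪ {i}) − u(S)`.
An edge function `f` is represented by its values `f S i = f(S, S ∪ {i})`
on the forward-oriented edges `(S, S ∪ {i})`, `i ∉ S`. -/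
def grad {N : ℕ} (u : Finset (Fin N) → ℝ) : Finset (Fin N) → Fin N → ℝ :=
  fun S i => u (insert i S) - u S

/-- The partial differential operator `d_i`:
`d_i u (S, S ∪ {j}) = du(S, S ∪ {i})` if `j = i` and `0` otherwise. -/
def dPart {N : ℕ} (i : Fin N) (u : Finset (Fin N) → ℝ) : Finset (Fin N) → Fin N → ℝ :=
  fun S j => if j = i then u (insert i S) - u S else 0

/-- The adjoint `d*` (negative divergence): `(d* f)(S) = ∑_{T ∼ S} f(T, S)`,
where the neighbors of `S` are `S \ {i}` (for `i ∈ S`) and `S ∪ {i}` (for `i ∉ S`),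
and `f(b, a) = −f(a, b)` on reverse-oriented edges. -/
def dstar {N : ℕ} (f : Finset (Fin N) → Fin N → ℝ) : Finset (Fin N) → ℝ :=
  fun S => ∑ i : Fin N, if i ∈ S then f (S.erase i) i else -f S i

/-- `w` is the component game `v_i` of player `i` for the game `v`:
the unique solution of the least squares equation `d* d w = d* d_i v` with `w(∅) = 0`. -/
def IsComponentGame {N : ℕ} (v : Finset (Fin N) → ℝ) (i : Fin N)
    (w : Finset (Fin N) → ℝ) : Prop :=
  w ∅ = 0 ∧ ∀ S : Finset (Fin N), dstar (grad w) S = dstar (dPart i v) S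

/-- The coalition obtained from `S` when player `i` changes sides. -/
def flipPlayer {N : ℕ} (i : Fin N) (S : Finset (Fin N)) : Finset (Fin N) := symmDiff S {i}

lemma flipPlayer_of_mem {N : ℕ} {i : Fin N} {S : Finset (Fin N)} (h : i ∈ S) :
    flipPlayer i S = S.erase i := by
  ext k
  by_cases hk : k = i <;> simp [flipPlayer, mem_symmDiff, hk, h]

lemma flipPlayer_of_notMem {N : ℕ} {i : Fin N} {S : Finset (Fin N)} (h : i ∉ S) :
    flipPlayer i S = insert i S := by
  ext k
  by_cases hk : k = i <;> simp [flipPlayer, mem_symmDiff, hk, h]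

lemma flipPlayer_flipPlayer {N : ℕ} (i : Fin N) (S : Finset (Fin N)) :
    flipPlayer i (flipPlayer i S) = S := by
  simp [flipPlayer]

lemma flipPlayer_comm {N : ℕ} (i j : Fin N) (S : Finset (Fin N)) :
    flipPlayer i (flipPlayer j S) = flipPlayer j (flipPlayer i S) :=
  symmDiff_right_comm _ _ _

lemma image_flipPlayer {M N : ℕ} {f : Fin M → Fin N} (hf : f.Injective) (i : Fin M)
    (S : Finset (Fin M)) : (flipPlayer i S).image f = flipPlayer (f i) (S.image f) := by
  simp [flipPlayer, image_symmDiff _ _ hf]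

lemma dstar_grad_apply {N : ℕ} (w : Finset (Fin N) → ℝ) (S : Finset (Fin N)) :
    dstar (grad w) S = ∑ i, (w S - w (flipPlayer i S)) := by
  refine sum_congr rfl fun i _ => ?_
  split_ifs with h
  · simp [grad, flipPlayer_of_mem h, insert_erase h]
  · simp [grad, flipPlayer_of_notMem h]

lemma dstar_dPart_apply {N : ℕ} (i : Fin N) (v : Finset (Fin N) → ℝ) (S : Finset (Fin N)) :
    dstar (dPart i v) S = v S - v (flipPlayer i S) := by
  rw [dstar, sum_eq_single i]
  · split_ifs with h
    · simp [dPart, flipPlayer_of_mem h, insert_erase h]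
    · simp [dPart, flipPlayer_of_notMem h]
  · intro j _ hj
    simp [dPart, hj]
  · simp

/-- A harmonic function on the hypercube is bounded by its value at `∅`. -/
lemma le_apply_empty_of_sum_sub_flipPlayer {N : ℕ} {w : Finset (Fin N) → ℝ}
    (h : ∀ S, ∑ i, (w S - w (flipPlayer i S)) = 0) (S : Finset (Fin N)) : w S ≤ w ∅ := by
  obtain ⟨M, hM⟩ := Finite.exists_max w
  have key : ∀ T : Finset (Fin N), w T = w M → w ∅ = w M := by
    intro T
    induction T using Finset.induction_on with
    | empty => exact id
    | insert i T hi ih =>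
      intro hT
      apply ih
      have hz := (sum_eq_zero_iff_of_nonneg fun j _ => by
        have := hM (flipPlayer j (insert i T)); linarith).1 (h (insert i T)) i (mem_univ i)
      rw [flipPlayer_of_mem (mem_insert_self i T), erase_insert hi] at hz
      linarith
  rw [key M rfl]
  exact hM S

lemma eq_of_sum_sub_flipPlayer_eq {N : ℕ} {u w : Finset (Fin N) → ℝ} (h₀ : u ∅ = w ∅)
    (h : ∀ S, ∑ i, (u S - u (flipPlayer i S)) = ∑ i, (w S - w (flipPlayer i S)))
    (S : Finset (Fin N)) : u S = w S := by
  have h₁ := le_apply_empty_of_sum_sub_flipPlayer (w := fun T => u T - w T) (fun T => by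
    have := h T
    simp only [sum_sub_distrib] at this ⊢
    linarith) S
  have h₂ := le_apply_empty_of_sum_sub_flipPlayer (w := fun T => w T - u T) (fun T => by
    have := h T
    simp only [sum_sub_distrib] at this ⊢
    linarith) S
  linarith

lemma isComponentGame_iff {N : ℕ} {v : Finset (Fin N) → ℝ} {i : Fin N}
    {w : Finset (Fin N) → ℝ} :
    IsComponentGame v i w ↔
      w ∅ = 0 ∧ ∀ S, ∑ j, (w S - w (flipPlayer j S)) = v S - v (flipPlayer i S) := by
  simp only [IsComponentGame, dstar_grad_apply, dstar_dPart_apply]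

namespace IsComponentGame

variable {N : ℕ} {v : Finset (Fin N) → ℝ} {i : Fin N} {w : Finset (Fin N) → ℝ}

lemma unique {w' : Finset (Fin N) → ℝ} (h : IsComponentGame v i w)
    (h' : IsComponentGame v i w') (S : Finset (Fin N)) : w S = w' S := by
  rw [isComponentGame_iff] at h h'
  exact eq_of_sum_sub_flipPlayer_eq (h.1.trans h'.1.symm) (fun T => (h.2 T).trans (h'.2 T).symm) S

lemma sum_eq {w : Fin N → Finset (Fin N) → ℝ} (hv : v ∅ = 0)
    (h : ∀ i, IsComponentGame v i (w i)) (S : Finset (Fin N)) : v S = ∑ i, w i S := by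
  simp only [isComponentGame_iff] at h
  refine eq_of_sum_sub_flipPlayer_eq (w := fun T => ∑ i, w i T) ?_ (fun T => ?_) S
  · simp [hv, (h _).1]
  · simp only [← sum_sub_distrib]
    rw [sum_comm]
    exact sum_congr rfl fun i _ => ((h i).2 T).symm

lemma comp_image (σ : Equiv.Perm (Fin N)) (h : IsComponentGame v (σ i) w) :
    IsComponentGame (fun S => v (S.image σ)) i fun S => w (S.image σ) := by
  rw [isComponentGame_iff] at h ⊢
  refine ⟨by simpa using h.1, fun S => ?_⟩
  simp only [image_flipPlayer σ.injective, ← h.2]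
  exact Equiv.sum_comp σ fun j => w (S.image σ) - w (flipPlayer j (S.image σ))

lemma linear_comb {v' w' : Finset (Fin N) → ℝ} (a b : ℝ) (h : IsComponentGame v i w)
    (h' : IsComponentGame v' i w') :
    IsComponentGame (fun S => a * v S + b * v' S) i fun S => a * w S + b * w' S := by
  rw [isComponentGame_iff] at h h' ⊢
  refine ⟨by simp [h.1, h'.1], fun S => ?_⟩
  have h₁ := congrArg (a * ·) (h.2 S)
  have h₂ := congrArg (b * ·) (h'.2 S)
  simp only [mul_sum] at h₁ h₂
  calc _ = ∑ j, (a * (w S - w (flipPlayer j S)) + b * (w' S - w' (flipPlayer j S))) :=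
        sum_congr rfl fun j _ => by ring
    _ = _ := by rw [sum_add_distrib, h₁, h₂]; ring

lemma add_flipPlayer_eq (h : IsComponentGame v i w) (S : Finset (Fin N)) :
    w S + w (flipPlayer i S) = w ∅ + w (flipPlayer i ∅) := by
  rw [isComponentGame_iff] at h
  refine eq_of_sum_sub_flipPlayer_eq (u := fun T => w T + w (flipPlayer i T))
    (w := fun _ => w ∅ + w (flipPlayer i ∅)) rfl (fun T => ?_) S
  have h₁ := h.2 T
  have h₂ := h.2 (flipPlayer i T)
  rw [flipPlayer_flipPlayer] at h₂
  calc _ = ∑ j, ((w T - w (flipPlayer j T)) +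
          (w (flipPlayer i T) - w (flipPlayer j (flipPlayer i T)))) :=
        sum_congr rfl fun j _ => by rw [flipPlayer_comm i j]; ring
    _ = _ := by rw [sum_add_distrib, h₁, h₂]; simp

end IsComponentGame

lemma apply_flipPlayer_of_null {N : ℕ} {v : Finset (Fin N) → ℝ} {i : Fin N}
    (h : ∀ S, i ∉ S → v (insert i S) = v S) (S : Finset (Fin N)) : v (flipPlayer i S) = v S := by
  by_cases hi : i ∈ S
  · rw [flipPlayer_of_mem hi, ← h _ (notMem_erase i S), insert_erase hi]
  · rw [flipPlayer_of_notMem hi, h S hi]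

lemma apply_erase_of_null {N : ℕ} {v : Finset (Fin N) → ℝ} {i : Fin N}
    (h : ∀ S, i ∉ S → v (insert i S) = v S) (S : Finset (Fin N)) : v (S.erase i) = v S := by
  by_cases hi : i ∈ S
  · rw [← flipPlayer_of_mem hi, apply_flipPlayer_of_null h]
  · rw [erase_eq_of_notMem hi]

/-- The trace of a coalition on the players other than `i`. -/
def removePlayer {n : ℕ} (i : Fin (n + 1)) (S : Finset (Fin (n + 1))) : Finset (Fin n) :=
  univ.filter fun k => i.succAbove k ∈ S

lemma removePlayer_image {n : ℕ} (i : Fin (n + 1)) (S : Finset (Fin n)) :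
    removePlayer i (S.image i.succAbove) = S := by
  ext k
  simp [removePlayer]

lemma removePlayer_insert_image {n : ℕ} (i : Fin (n + 1)) (S : Finset (Fin n)) :
    removePlayer i (insert i (S.image i.succAbove)) = S := by
  ext k
  simp [removePlayer, Fin.succAbove_ne]

lemma image_removePlayer {n : ℕ} (i : Fin (n + 1)) (S : Finset (Fin (n + 1))) :
    (removePlayer i S).image i.succAbove = S.erase i := by
  ext k
  rcases Fin.eq_self_or_eq_succAbove i k with rfl | ⟨k, rfl⟩ <;>
    simp [removePlayer, Fin.succAbove_ne]

lemma removePlayer_flipPlayer_self {n : ℕ} (i : Fin (n + 1)) (S : Finset (Fin (n + 1))) :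
    removePlayer i (flipPlayer i S) = removePlayer i S := by
  ext k
  simp [removePlayer, flipPlayer, mem_symmDiff, Fin.succAbove_ne]

lemma removePlayer_flipPlayer_succAbove {n : ℕ} (i : Fin (n + 1)) (j : Fin n)
    (S : Finset (Fin (n + 1))) :
    removePlayer i (flipPlayer (i.succAbove j) S) = flipPlayer j (removePlayer i S) := by
  ext k
  simp [removePlayer, flipPlayer, mem_symmDiff]

lemma IsComponentGame.comp_removePlayer {n : ℕ} {v : Finset (Fin (n + 1)) → ℝ}
    {i : Fin (n + 1)} (hv : ∀ S, i ∉ S → v (insert i S) = v S) {j : Fin n}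
    {w : Finset (Fin n) → ℝ}
    (h : IsComponentGame (fun S => v (S.image i.succAbove)) j w) :
    IsComponentGame v (i.succAbove j) fun S => w (removePlayer i S) := by
  rw [isComponentGame_iff] at h ⊢
  refine ⟨by simpa [removePlayer] using h.1, fun S => ?_⟩
  rw [Fin.sum_univ_succAbove _ i]
  simp only [removePlayer_flipPlayer_self, removePlayer_flipPlayer_succAbove,
    sub_self, zero_add, h.2]
  rw [← removePlayer_flipPlayer_succAbove, image_removePlayer, image_removePlayer,
    apply_erase_of_null hv, apply_erase_of_null hv]

/-- The Hodge-theoretic component games satisfy the axioms A1--A5: setting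
`Φ_i[v] = v_i` for `i ∈ [N]` (and `Φ_i[v] ≡ 0` for players beyond `[N]`) defines an
allocation satisfying efficiency, symmetry, null-player, linearity, and reflection. -/
theorem componentGames_satisfy_axioms
    (comp : (N : ℕ) → Game N → Fin N → (Finset (Fin N) → ℝ))
    (hcomp : ∀ (N : ℕ) (v : Game N) (i : Fin N), IsComponentGame v.1 i (comp N v i)) :
    IsHodgeAllocation (fun N v k => if h : k < N then comp N v ⟨k, h⟩ else 0) := by
  have hlt : ∀ {N : ℕ} (i : Fin N), i.1 < N := fun i => i.2
  refine ⟨fun N v k => ?_, fun N v k hk S => ?_, fun N v S => ?_, fun N v i j S => ?_,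
    fun n v i hv => ⟨fun S => ?_, fun j S => ?_⟩, fun N a b v w k S => ?_,
    fun N v i S T hS hT => ?_⟩
  · dsimp only
    split_ifs with h
    · exact (hcomp N v ⟨k, h⟩).1
    · rfl
  · simp [hk.not_gt]
  · simpa using IsComponentGame.sum_eq v.2 (hcomp N v) S
  · simp only [hlt, dif_pos, Fin.eta]
    have h := (hcomp N v j)
    rw [← Equiv.swap_apply_left i j] at h
    have h' := (hcomp N (swapGame i j v) i).unique (h.comp_image (Equiv.swap i j))
      (S.image (Equiv.swap i j))
    simpa [image_image, Function.comp_def] using h'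
  · simp only [hlt, dif_pos, Fin.eta]
    refine (hcomp (n + 1) v i).unique (w' := fun _ => 0)
      (isComponentGame_iff.2 ⟨rfl, fun T => ?_⟩) S
    simp [apply_flipPlayer_of_null hv]
  · simp only [hlt, dif_pos, Fin.eta]
    have h := (hcomp (n + 1) v (i.succAbove j)).unique
      ((hcomp n (restrictGame i v) j).comp_removePlayer hv)
    simp only [h, removePlayer_image, removePlayer_insert_image, and_self]
  · dsimp only
    split_ifs with h
    · exact (hcomp N (gameLC a b v w) ⟨k, h⟩).unique
        ((hcomp N v ⟨k, h⟩).linear_comb a b (hcomp N w ⟨k, h⟩)) S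
    · simp
  · simp only [hlt, dif_pos, Fin.eta]
    have h₁ := (hcomp N v i).add_flipPlayer_eq S
    have h₂ := (hcomp N v i).add_flipPlayer_eq T
    rw [flipPlayer_of_notMem hS] at h₁
    rw [flipPlayer_of_notMem hT] at h₂
    linarith
end

section
/- Let v ∈ 𝒢_N, let i,j ∈ [N], and let σ be the transposition of i and j, acting on games by (σv)(S) = v(σ(S)). Then the component games satisfy (σv)_i = σ(v_j), i.e. (σv)_i(S) = v_j(σ(S)) for every S ⊆ [N]. -/
open Finset

theorem dstar_image_perm {N : ℕ} (σ : Equiv.Perm (Fin N)) (f : Finset (Fin N) → Fin N → ℝ)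
    (S : Finset (Fin N)) :
    dstar (fun T k => f (T.image σ) (σ k)) S = dstar f (S.image σ) := by
  unfold dstar
  rw [← Equiv.sum_comp σ fun k => if k ∈ S.image σ then _ else _]
  refine Finset.sum_congr rfl fun k _ => ?_
  simp only [Finset.image_erase σ.injective, σ.injective.mem_finset_image]

theorem grad_image_perm {N : ℕ} (σ : Equiv.Perm (Fin N)) (w : Finset (Fin N) → ℝ) :
    grad (fun S => w (S.image σ)) = fun T k => grad w (T.image σ) (σ k) := by
  funext T k
  simp only [grad, Finset.image_insert]

theorem dPart_image_perm {N : ℕ} (σ : Equiv.Perm (Fin N)) (i : Fin N)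
    (v : Finset (Fin N) → ℝ) :
    dPart i (fun S => v (S.image σ)) = fun T k => dPart (σ i) v (T.image σ) (σ k) := by
  funext T k
  simp only [dPart, Finset.image_insert, σ.injective.eq_iff]

theorem IsComponentGame.image_perm {N : ℕ} (σ : Equiv.Perm (Fin N)) {i : Fin N}
    {v w : Finset (Fin N) → ℝ} (hw : IsComponentGame v (σ i) w) :
    IsComponentGame (fun S => v (S.image σ)) i (fun S => w (S.image σ)) := by
  refine ⟨by simpa using hw.1, fun S => ?_⟩
  rw [grad_image_perm, dPart_image_perm, dstar_image_perm σ (grad w),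
    dstar_image_perm σ (dPart (σ i) v), hw.2]

theorem dstar_grad_sub {N : ℕ} (u w : Finset (Fin N) → ℝ) (S : Finset (Fin N)) :
    dstar (grad (u - w)) S = dstar (grad u) S - dstar (grad w) S := by
  simp only [dstar, grad, Pi.sub_apply, ← Finset.sum_sub_distrib]
  refine Finset.sum_congr rfl fun k _ => ?_
  split_ifs <;> ring

/-- The maximum principle: a harmonic function on the hypercube attains its maximum at `∅`. -/
theorem le_empty_of_dstar_grad_eq_zero {N : ℕ} {h : Finset (Fin N) → ℝ}
    (hh : ∀ S, dstar (grad h) S = 0) (S : Finset (Fin N)) : h S ≤ h ∅ := by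
  obtain ⟨M, hM⟩ := Finite.exists_max h
  suffices key : ∀ T : Finset (Fin N), (∀ S, h S ≤ h T) → ∀ S, h S ≤ h ∅ from key M hM S
  intro T
  induction T using Finset.induction_on with
  | empty => exact id
  | insert a T ha ih =>
    intro hmax
    refine ih fun S => ?_
    have hsum := hh (insert a T)
    unfold dstar at hsum
    rw [Finset.sum_eq_zero_iff_of_nonneg] at hsum
    · have hedge := hsum a (Finset.mem_univ a)
      simp only [Finset.mem_insert_self, if_true, Finset.erase_insert ha, grad] at hedge
      linarith [hmax S]
    · intro k _
      split_ifs with hk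
      · simp only [grad, Finset.insert_erase hk]
        linarith [hmax ((insert a T).erase k)]
      · simp only [grad]
        linarith [hmax (insert k (insert a T))]

theorem IsComponentGame.le {N : ℕ} {v : Finset (Fin N) → ℝ} {i : Fin N}
    {u w : Finset (Fin N) → ℝ} (hu : IsComponentGame v i u) (hw : IsComponentGame v i w) :
    u ≤ w := by
  intro S
  have hmax := le_empty_of_dstar_grad_eq_zero (h := u - w)
    (fun T => by rw [dstar_grad_sub, hu.2, hw.2, sub_self]) S
  simp only [Pi.sub_apply, hu.1, hw.1] at hmax
  linarith

theorem IsComponentGame.unique_s6 {N : ℕ} {v : Finset (Fin N) → ℝ} {i : Fin N}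
    {u w : Finset (Fin N) → ℝ} (hu : IsComponentGame v i u) (hw : IsComponentGame v i w) :
    u = w :=
  le_antisymm (hu.le hw) (hw.le hu)

/-- Symmetry of the component games: if `σ` is the transposition of `i` and `j`,
acting on games by `(σv)(S) = v(σ(S))`, then `(σv)_i = σ(v_j)`. -/
theorem componentGames_symmetry (N : ℕ) (v : Finset (Fin N) → ℝ) (hv : v ∅ = 0)
    (i j : Fin N)
    (w : Finset (Fin N) → ℝ) (hw : IsComponentGame v j w)
    (u : Finset (Fin N) → ℝ)
    (hu : IsComponentGame (fun S => v (S.image (Equiv.swap i j))) i u) :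
    ∀ S : Finset (Fin N), u S = w (S.image (Equiv.swap i j)) := by
  intro S
  have hw' : IsComponentGame v (Equiv.swap i j i) w := by rwa [Equiv.swap_apply_left]
  exact congrFun (hu.unique_s6 (hw'.image_perm (Equiv.swap i j))) S
end

section
/- For every v ∈ 𝒢_N and i ∈ [N], the quantity v_i(S) + v_i(S∪{i}) is constant over all S ⊆ [N]∖{i}. Consequently the component games satisfy the reflection property: v_i(S∪{i}) − v_i(T∪{i}) = −(v_i(S) − v_i(T)) for all S, T ⊆ [N]∖{i}. -/
open Finset

lemma symmDiff_singleton_of_mem {α : Type*} [DecidableEq α] {a : α} {s : Finset α}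
    (h : a ∈ s) : symmDiff s {a} = s.erase a := by
  ext x; by_cases hx : x = a <;> simp [Finset.mem_symmDiff, hx, h]

lemma symmDiff_singleton_of_notMem {α : Type*} [DecidableEq α] {a : α} {s : Finset α}
    (h : a ∉ s) : symmDiff s {a} = insert a s := by
  ext x; by_cases hx : x = a <;> simp [Finset.mem_symmDiff, hx, h]

/-- The hypercube Laplacian `d* d` sums the differences to all neighbors. -/
lemma dstar_grad {N : ℕ} (u : Finset (Fin N) → ℝ) (S : Finset (Fin N)) :
    dstar (grad u) S = ∑ j, (u S - u (symmDiff S {j})) := by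
  refine Finset.sum_congr rfl fun j _ => ?_
  split_ifs with h
  · simp [grad, symmDiff_singleton_of_mem h, Finset.insert_erase h]
  · simp [grad, symmDiff_singleton_of_notMem h]

lemma dstar_dPart {N : ℕ} (i : Fin N) (v : Finset (Fin N) → ℝ) (S : Finset (Fin N)) :
    dstar (dPart i v) S = v S - v (symmDiff S {i}) := by
  rw [dstar, Finset.sum_eq_single i]
  · split_ifs with h
    · simp [dPart, symmDiff_singleton_of_mem h, Finset.insert_erase h]
    · simp [dPart, symmDiff_singleton_of_notMem h]
  · intro j _ hj
    simp [dPart, hj]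
  · simp

/-- Harmonic functions on the hypercube are constant (maximum principle). -/
lemma eq_of_dstar_grad_eq_zero {N : ℕ} {p : Finset (Fin N) → ℝ}
    (hp : ∀ S, dstar (grad p) S = 0) (S T : Finset (Fin N)) : p S = p T := by
  obtain ⟨M, hM⟩ := Finite.exists_max p
  have step (A : Finset (Fin N)) (hA : p A = p M) (j : Fin N) :
      p (symmDiff A {j}) = p M := by
    have h := hp A
    rw [dstar_grad, Finset.sum_eq_zero_iff_of_nonneg
      fun k _ => by linarith [hM (symmDiff A {k})]] at h
    linarith [h j (Finset.mem_univ j)]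
  have walk (B : Finset (Fin N)) : p (symmDiff M B) = p M := by
    induction B using Finset.induction_on with
    | empty => simp [← Finset.bot_eq_empty]
    | insert a B ha ih =>
      rw [← symmDiff_singleton_of_notMem ha, ← symmDiff_assoc]
      exact step _ ih a
  have key (A : Finset (Fin N)) : p A = p M := by
    simpa [symmDiff_symmDiff_cancel_left] using walk (symmDiff M A)
  rw [key S, key T]

/-- The sum of a component game `v_i` and its reflection in direction `i` is harmonic. -/
lemma IsComponentGame.dstar_grad_add_reflect {N : ℕ} {v w : Finset (Fin N) → ℝ} {i : Fin N}
    (hw : IsComponentGame v i w) (S : Finset (Fin N)) :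
    dstar (grad fun A => w A + w (symmDiff A {i})) S = 0 := by
  have h₁ := hw.2 S
  have h₂ := hw.2 (symmDiff S {i})
  simp only [dstar_grad, dstar_dPart, symmDiff_symmDiff_cancel_right] at h₁ h₂ ⊢
  rw [← sub_self (v S), ← sub_add_sub_cancel (v S) (v (symmDiff S {i})) (v S), ← h₁, ← h₂,
    ← Finset.sum_add_distrib]
  refine Finset.sum_congr rfl fun j _ => ?_
  rw [symmDiff_right_comm S {i} {j}]
  ring

/-- Reflection property of the component games: `v_i(S) + v_i(S ∪ {i})` is constant
over all `S ⊆ [N] \ {i}`; consequently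
`v_i(S ∪ {i}) − v_i(T ∪ {i}) = −(v_i(S) − v_i(T))` for all `S, T ⊆ [N] \ {i}`. -/
theorem componentGame_reflection (N : ℕ) (v : Finset (Fin N) → ℝ) (hv : v ∅ = 0)
    (i : Fin N) (w : Finset (Fin N) → ℝ) (hw : IsComponentGame v i w) :
    (∀ S T : Finset (Fin N), i ∉ S → i ∉ T →
      w S + w (insert i S) = w T + w (insert i T)) ∧
    (∀ S T : Finset (Fin N), i ∉ S → i ∉ T →
      w (insert i S) - w (insert i T) = -(w S - w T)) := by
  have const (S T : Finset (Fin N)) (hS : i ∉ S) (hT : i ∉ T) :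
      w S + w (insert i S) = w T + w (insert i T) := by
    simpa only [symmDiff_singleton_of_notMem hS, symmDiff_singleton_of_notMem hT] using
      eq_of_dstar_grad_eq_zero hw.dstar_grad_add_reflect S T
  exact ⟨const, fun S T hS hT => by linarith [const S T hS hT]⟩
end

section
/- Let v : 2^[N] → ℝ, i ∈ [N], and let X_0, X_1, …, X_n be a walk on the hypercube graph, i.e. each consecutive pair (X_{k−1}, X_k) is a forward- or reverse-oriented edge. Define its reflection with respect to i by X′_k := X_k ∪ {i} if i ∉ X_k and X′_k := X_k ∖ {i} if i ∈ X_k. Then the contributions of player i along the two walks have opposite signs: ∑_{k=1}^{n} d_i v(X′_{k−1}, X′_k) = −∑_{k=1}^{n} d_i v(X_{k−1}, X_k). -/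
open Finset

/-- The value of the edge function `d_i v` on an arbitrary (forward- or reverse-oriented)
edge `(A, B)` of the hypercube graph, with `f(b, a) = −f(a, b)` on reverse edges:
it equals `v(B) − v(A)` if the edge is in direction `i`, and `0` otherwise. -/
def dEdge {N : ℕ} (i : Fin N) (v : Finset (Fin N) → ℝ) (A B : Finset (Fin N)) : ℝ :=
  if (i ∉ A ∧ B = insert i A) ∨ (i ∉ B ∧ A = insert i B) then v B - v A else 0

/-- `A` and `B` are joined by a forward- or reverse-oriented edge of the hypercube graph. -/
def AdjacentHC {N : ℕ} (A B : Finset (Fin N)) : Prop :=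
  (∃ j ∉ A, B = insert j A) ∨ (∃ j ∉ B, A = insert j B)

/-- The reflection of a coalition with respect to player `i`:
`S ∪ {i}` if `i ∉ S`, and `S \ {i}` if `i ∈ S`. -/
def reflectI {N : ℕ} (i : Fin N) (S : Finset (Fin N)) : Finset (Fin N) :=
  if i ∈ S then S.erase i else insert i S

theorem reflectI_involutive {N : ℕ} (i : Fin N) : Function.Involutive (reflectI i) := by
  intro S
  by_cases h : i ∈ S <;> simp [reflectI, h]

theorem dEdge_eq_ite_reflectI {N : ℕ} (i : Fin N) (v : Finset (Fin N) → ℝ)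
    (A B : Finset (Fin N)) :
    dEdge i v A B = if B = reflectI i A then v B - v A else 0 := by
  have h : ((i ∉ A ∧ B = insert i A) ∨ (i ∉ B ∧ A = insert i B)) ↔ B = reflectI i A := by
    by_cases hA : i ∈ A
    · simp only [reflectI, hA, not_true_eq_false, false_and, false_or, if_true]
      constructor
      · rintro ⟨hB, rfl⟩
        exact (erase_insert hB).symm
      · rintro rfl
        exact ⟨notMem_erase i A, (insert_erase hA).symm⟩
    · simp only [reflectI, hA, not_false_eq_true, true_and, if_false, or_iff_left_iff_imp]
      rintro ⟨-, rfl⟩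
      exact absurd (mem_insert_self i B) hA
  simp only [dEdge, h]

theorem dEdge_reflectI {N : ℕ} (i : Fin N) (v : Finset (Fin N) → ℝ) (A B : Finset (Fin N)) :
    dEdge i v (reflectI i A) (reflectI i B) = -dEdge i v A B := by
  simp only [dEdge_eq_ite_reflectI, (reflectI_involutive i).injective.eq_iff]
  split_ifs with h
  · rw [h, reflectI_involutive i A, neg_sub]
  · exact neg_zero.symm

/-- Along a walk `X_0, …, X_n` on the hypercube graph and its reflection with respect
to player `i`, the contributions of player `i` have opposite signs. -/
theorem reflected_walk_contribution (N n : ℕ) (v : Finset (Fin N) → ℝ) (i : Fin N)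
    (X : ℕ → Finset (Fin N)) (hX : ∀ k < n, AdjacentHC (X k) (X (k + 1))) :
    ∑ k ∈ Finset.range n, dEdge i v (reflectI i (X k)) (reflectI i (X (k + 1)))
      = -∑ k ∈ Finset.range n, dEdge i v (X k) (X (k + 1)) := by
  simp only [dEdge_reflectI, sum_neg_distrib]
end
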